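/- arXiv:2105.08348 — 7 statements merged into one kernel-verified Lean document; each statement's English description precedes it below -/
import Mathlib

section
/- Let ū be a global minimizer of the convex clustering objective f. Then for any two indices i and j with ū_i ≠ ū_j, the interiors of the convex hulls of the point sets {x_p : ū_p = ū_i} and {x_p : ū_p = ū_j} are disjoint; that is, the clusters discovered by convex clustering are convex. -/
open scoped RealInnerProductSpace Classical

/-- The convex clustering objective:
`f(u) = (1/2)·Σ_i ‖u_i − x_i‖² + λ·Σ_{j<i} ‖u_i − u_j‖`. -/
noncomputable def ccObj {d n : ℕ} (x : Fin n → EuclideanSpace ℝ (Fin d)) (lam : ℝ)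
    (u : Fin n → EuclideanSpace ℝ (Fin d)) : ℝ :=
  (1 / 2) * ∑ i, ‖u i - x i‖ ^ 2 + lam * ∑ i, ∑ j ∈ Finset.Iio i, ‖u i - u j‖

section SymmetricSums

variable {ι : Type*} [Fintype ι]

/-- A symmetric function vanishing on the diagonal, summed over all pairs, counts every unordered
pair twice. -/
theorem sum_sum_eq_two_mul_sum_Iio [LinearOrder ι] [LocallyFiniteOrder ι] [LocallyFiniteOrderBot ι]
    [LocallyFiniteOrderTop ι] (g : ι → ι → ℝ) (hsymm : ∀ i j, g i j = g j i)
    (hdiag : ∀ i, g i i = 0) :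
    ∑ i, ∑ j, g i j = 2 * ∑ i, ∑ j ∈ Finset.Iio i, g i j := by
  have hsplit (i : ι) :
      ∑ j, g i j = ∑ j ∈ Finset.Iio i, g i j + ∑ j ∈ Finset.Ioi i, g i j := by
    rw [← Finset.sum_union (Finset.disjoint_left.2 fun j h₁ h₂ =>
      lt_asymm (Finset.mem_Iio.1 h₁) (Finset.mem_Ioi.1 h₂))]
    refine (Finset.sum_subset (Finset.subset_univ _) fun j _ hj => ?_).symm
    have : j = i := by
      simp only [Finset.mem_union, Finset.mem_Iio, Finset.mem_Ioi, not_or, not_lt] at hj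
      exact le_antisymm hj.2 hj.1
    rw [this, hdiag]
  have hswap : ∑ i, ∑ j ∈ Finset.Ioi i, g i j = ∑ i, ∑ j ∈ Finset.Iio i, g i j := by
    rw [Finset.sum_comm' (t' := Finset.univ) (s' := fun j => Finset.Iio j) (by simp)]
    exact Finset.sum_congr rfl fun i _ => Finset.sum_congr rfl fun j _ => hsymm _ _
  rw [Finset.sum_congr rfl fun i _ => hsplit i, Finset.sum_add_distrib, hswap, two_mul]

/-- Isolating the row and the column of one index in a symmetric double sum with zero diagonal. -/
theorem sum_sum_eq_two_mul_sum_erase_add [DecidableEq ι] (g : ι → ι → ℝ)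
    (hsymm : ∀ i j, g i j = g j i) (hdiag : ∀ i, g i i = 0) (p : ι) :
    ∑ i, ∑ j, g i j = 2 * ∑ q ∈ Finset.univ.erase p, g p q +
      ∑ i ∈ Finset.univ.erase p, ∑ j ∈ Finset.univ.erase p, g i j := by
  have hrow (i : ι) : ∑ j, g i j = g i p + ∑ j ∈ Finset.univ.erase p, g i j :=
    (Finset.add_sum_erase _ _ (Finset.mem_univ p)).symm
  rw [← Finset.add_sum_erase _ _ (Finset.mem_univ p), hrow p, hdiag,
    Finset.sum_congr rfl fun i _ => hrow i, Finset.sum_add_distrib,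
    Finset.sum_congr rfl fun i _ => hsymm i p]
  ring

end SymmetricSums

section ConvexClustering

variable {d n : ℕ} {x : Fin n → EuclideanSpace ℝ (Fin d)} {lam : ℝ}
  {u : Fin n → EuclideanSpace ℝ (Fin d)}

/-- As a function of a single variable `u p`, the objective is
`½‖u p - x p‖² + λ Σ_{q ≠ p} ‖u p - u q‖` up to an additive constant. -/
theorem ccObj_update_sub (p : Fin n) (y : EuclideanSpace ℝ (Fin d)) :
    ccObj x lam (Function.update u p y) - ccObj x lam u =
      (1 / 2) * (‖y - x p‖ ^ 2 - ‖u p - x p‖ ^ 2) +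
        lam * (∑ q ∈ Finset.univ.erase p, ‖y - u q‖ -
          ∑ q ∈ Finset.univ.erase p, ‖u p - u q‖) := by
  have hpairs (v : Fin n → EuclideanSpace ℝ (Fin d)) :=
    (sum_sum_eq_two_mul_sum_Iio (fun i j => ‖v i - v j‖) (fun _ _ => norm_sub_rev _ _)
      (by simp)).symm.trans (sum_sum_eq_two_mul_sum_erase_add (fun i j => ‖v i - v j‖)
      (fun _ _ => norm_sub_rev _ _) (by simp) p)
  have hne {q : Fin n} (hq : q ∈ Finset.univ.erase p) : Function.update u p y q = u q :=
    Function.update_of_ne (Finset.ne_of_mem_erase hq) _ _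
  have hfit : ∑ i, ‖Function.update u p y i - x i‖ ^ 2 =
      ‖y - x p‖ ^ 2 + ∑ i ∈ Finset.univ.erase p, ‖u i - x i‖ ^ 2 := by
    rw [← Finset.add_sum_erase _ _ (Finset.mem_univ p), Function.update_self,
      Finset.sum_congr rfl fun i hi => by rw [hne hi]]
  have hcol : ∑ q ∈ Finset.univ.erase p, ‖y - Function.update u p y q‖ =
      ∑ q ∈ Finset.univ.erase p, ‖y - u q‖ :=
    Finset.sum_congr rfl fun q hq => by rw [hne hq]
  have hrest : ∑ i ∈ Finset.univ.erase p, ∑ j ∈ Finset.univ.erase p,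
      ‖Function.update u p y i - Function.update u p y j‖ =
      ∑ i ∈ Finset.univ.erase p, ∑ j ∈ Finset.univ.erase p, ‖u i - u j‖ :=
    Finset.sum_congr rfl fun i hi => Finset.sum_congr rfl fun j hj => by rw [hne hi, hne hj]
  have hupd := hpairs (Function.update u p y)
  rw [Function.update_self, hcol, hrest] at hupd
  have hu := hpairs u
  unfold ccObj
  rw [hfit, ← Finset.add_sum_erase _ (fun i => ‖u i - x i‖ ^ 2) (Finset.mem_univ p)]
  linear_combination (lam / 2) * (hupd - hu)

/-- First-order optimality of the minimizer with respect to moving `u p` towards a point `b`. -/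
theorem inner_sub_le_of_forall_ccObj_le (hlam : 0 < lam)
    (hmin : ∀ v, ccObj x lam u ≤ ccObj x lam v) (p : Fin n) (b : EuclideanSpace ℝ (Fin d)) :
    ⟪x p - u p, b - u p⟫ ≤ lam * (∑ q, ‖b - u q‖ - ∑ q, ‖u p - u q‖ - ‖b - u p‖) := by
  set D := ∑ q, ‖b - u q‖ - ∑ q, ‖u p - u q‖ - ‖b - u p‖ with hD
  have hD' : D = ∑ q ∈ Finset.univ.erase p, ‖b - u q‖ -
      ∑ q ∈ Finset.univ.erase p, ‖u p - u q‖ := by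
    rw [hD, ← Finset.add_sum_erase _ (fun q => ‖b - u q‖) (Finset.mem_univ p),
      ← Finset.add_sum_erase _ (fun q => ‖u p - u q‖) (Finset.mem_univ p), sub_self, norm_zero]
    ring
  set A := lam * D - ⟪x p - u p, b - u p⟫ with hA
  set W := ‖b - u p‖ ^ 2 with hW
  have key (t : ℝ) (ht0 : 0 ≤ t) (ht1 : t ≤ 1) : 0 ≤ t * A + t ^ 2 * W / 2 := by
    have hsum : ∑ q ∈ Finset.univ.erase p, ‖u p + t • (b - u p) - u q‖ -
        ∑ q ∈ Finset.univ.erase p, ‖u p - u q‖ ≤ t * D := by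
      rw [hD', ← Finset.sum_sub_distrib, ← Finset.sum_sub_distrib, Finset.mul_sum]
      refine Finset.sum_le_sum fun q _ => ?_
      have hcomb : u p + t • (b - u p) - u q = (1 - t) • (u p - u q) + t • (b - u q) := by
        module
      have := norm_add_le ((1 - t) • (u p - u q)) (t • (b - u q))
      rw [← hcomb, norm_smul, norm_smul, Real.norm_of_nonneg ht0,
        Real.norm_of_nonneg (sub_nonneg.2 ht1)] at this
      linarith
    have hsq : ‖u p + t • (b - u p) - x p‖ ^ 2 =
        ‖u p - x p‖ ^ 2 - 2 * t * ⟪x p - u p, b - u p⟫ + t ^ 2 * W := by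
      rw [add_sub_right_comm, norm_add_sq_real, inner_smul_right, norm_smul, mul_pow,
        Real.norm_of_nonneg ht0, ← neg_sub (x p) (u p), inner_neg_left]
      ring
    have hdiff := sub_nonneg.2 (hmin (Function.update u p (u p + t • (b - u p))))
    rw [ccObj_update_sub, hsq] at hdiff
    have := mul_le_mul_of_nonneg_left hsum hlam.le
    linarith
  have hWnonneg : 0 ≤ W := sq_nonneg _
  by_contra! hlt
  have hAneg : A < 0 := by linarith
  have hpos : 0 < W - A := by linarith
  have hstep := key (-A / (W - A)) (by apply div_nonneg <;> linarith)
    ((div_le_one hpos).2 (by linarith))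
  have hfactor : -A / (W - A) * A + (-A / (W - A)) ^ 2 * W / 2 =
      -(A ^ 2 * (W - 2 * A)) / (2 * (W - A) ^ 2) := by
    field_simp
    ring
  have : 0 < A ^ 2 * (W - 2 * A) / (2 * (W - A) ^ 2) :=
    div_pos (mul_pos (sq_pos_of_neg hAneg) (by linarith)) (by positivity)
  rw [hfactor, neg_div] at hstep
  linarith

/-- The convex hulls of two distinct clusters are disjoint. -/
theorem disjoint_convexHull_clusters (hlam : 0 < lam)
    (hmin : ∀ v, ccObj x lam u ≤ ccObj x lam v) {a b : EuclideanSpace ℝ (Fin d)} (hab : a ≠ b) :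
    Disjoint (convexHull ℝ (x '' {p | u p = a})) (convexHull ℝ (x '' {p | u p = b})) := by
  set M := lam * (∑ q, ‖b - u q‖ - ∑ q, ‖a - u q‖) with hM
  set δ := lam * ‖b - a‖ with hδ
  have hδpos : 0 < δ := mul_pos hlam (norm_pos_iff.2 (sub_ne_zero.2 hab.symm))
  have hlin := (innerₛₗ ℝ (b - a)).isLinear
  have hleft : convexHull ℝ (x '' {p | u p = a}) ⊆
      {z | ⟪b - a, z⟫ ≤ ⟪b - a, a⟫ + M - δ} := by
    refine convexHull_min ?_ (convex_halfSpace_le hlin _)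
    rintro _ ⟨p, rfl, rfl⟩
    have := inner_sub_le_of_forall_ccObj_le hlam hmin p b
    rw [real_inner_comm, inner_sub_right] at this
    simp only [Set.mem_ofPred_eq]
    linarith
  have hright : convexHull ℝ (x '' {p | u p = b}) ⊆
      {z | ⟪b - a, b⟫ + M + δ ≤ ⟪b - a, z⟫} := by
    refine convexHull_min ?_ (convex_halfSpace_ge hlin _)
    rintro _ ⟨p, rfl, rfl⟩
    have := inner_sub_le_of_forall_ccObj_le hlam hmin p a
    rw [real_inner_comm, inner_sub_right, ← neg_sub (u p) a, inner_neg_left, inner_neg_left,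
      norm_neg] at this
    simp only [Set.mem_ofPred_eq]
    linarith
  refine Set.disjoint_left.2 fun z hza hzb => ?_
  have h₁ := hleft hza
  have h₂ := hright hzb
  have h₃ : 0 ≤ ⟪b - a, b⟫ - ⟪b - a, a⟫ := by
    rw [← inner_sub_right]
    exact real_inner_self_nonneg
  simp only [Set.mem_ofPred_eq] at h₁ h₂
  linarith

end ConvexClustering

/-- Convex clustering learns convex clusters: the interiors of the convex hulls of
distinct clusters are disjoint. -/
theorem convex_clustering_clusters_convex {d n : ℕ} (hd : 0 < d) (hn : 0 < n)
    (x : Fin n → EuclideanSpace ℝ (Fin d)) (lam : ℝ) (hlam : 0 < lam)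
    (ubar : Fin n → EuclideanSpace ℝ (Fin d))
    (hmin : ∀ u : Fin n → EuclideanSpace ℝ (Fin d), ccObj x lam ubar ≤ ccObj x lam u)
    (i j : Fin n) (hij : ubar i ≠ ubar j) :
    interior (convexHull ℝ (x '' {p | ubar p = ubar i})) ∩
      interior (convexHull ℝ (x '' {p | ubar p = ubar j})) = ∅ := by
  exact Set.disjoint_iff_inter_eq_empty.1
    ((disjoint_convexHull_clusters hlam hmin hij).mono interior_subset interior_subset)
end

section
/- Let ū be a global minimizer of the convex clustering objective f. Then for every index i, ‖x_i − (ū_i + λ·E_i)‖ ≤ λ·(n(i) − 1); that is, each data point x_i lies in the closed ball with center c(i) = ū_i + λ·E_i and radius r(i) = λ·(n(i) − 1). -/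
open scoped RealInnerProductSpace Classical

/-- `E_i = Σ_{j : u_j ≠ u_i} (u_i − u_j)/‖u_i − u_j‖`. -/
noncomputable def ccE {d n : ℕ} (u : Fin n → EuclideanSpace ℝ (Fin d)) (i : Fin n) :
    EuclideanSpace ℝ (Fin d) :=
  ∑ j ∈ Finset.univ.filter (fun j => u j ≠ u i), ‖u i - u j‖⁻¹ • (u i - u j)

/-- The cardinality `n(i)` of the cluster of index `i`. -/
noncomputable def ccCard {d n : ℕ} (u : Fin n → EuclideanSpace ℝ (Fin d)) (i : Fin n) : ℕ :=
  (Finset.univ.filter fun j => u j = u i).card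

/-- The bounding-ball center `c(i) = u_i + λ·E_i`. -/
noncomputable def ccCenter {d n : ℕ} (u : Fin n → EuclideanSpace ℝ (Fin d)) (lam : ℝ)
    (i : Fin n) : EuclideanSpace ℝ (Fin d) :=
  u i + lam • ccE u i

/-- The bounding-ball radius `r(i) = λ·(n(i) − 1)`. -/
noncomputable def ccRadius {d n : ℕ} (u : Fin n → EuclideanSpace ℝ (Fin d)) (lam : ℝ)
    (i : Fin n) : ℝ :=
  lam * ((ccCard u i : ℝ) - 1)

/-- If `g` has gradient `G` at `a` and `g + r‖· - a‖` is minimal at `a`, then `‖G‖ ≤ r`. -/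
theorem norm_gradient_le_of_forall_le_add_mul_norm {E : Type*} [NormedAddCommGroup E]
    [InnerProductSpace ℝ E] [CompleteSpace E] {g : E → ℝ} {a G : E} {r : ℝ}
    (hg : HasGradientAt g G a) (hr : 0 ≤ r) (hmin : ∀ w, g a ≤ g w + r * ‖w - a‖) :
    ‖G‖ ≤ r := by
  have hline : HasDerivAt (fun t : ℝ => a + t • (-G)) (-G) 0 := by
    simpa using ((hasDerivAt_id (0 : ℝ)).smul_const (-G)).const_add a
  have hcomp : HasDerivAt (fun t : ℝ => g (a + t • (-G))) (-(‖G‖ ^ 2)) 0 := by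
    have hg' : HasFDerivAt g (InnerProductSpace.toDual ℝ E G) (a + (0 : ℝ) • (-G)) := by
      simpa using hg.hasFDerivAt
    simpa [Function.comp_def] using hg'.comp_hasDerivAt (0 : ℝ) hline
  have hslope := hcomp.tendsto_slope_zero_right
  have hlower : -(r * ‖G‖) ≤ -(‖G‖ ^ 2) := by
    refine ge_of_tendsto hslope ?_
    filter_upwards [self_mem_nhdsWithin] with t ht
    have ht : 0 < t := ht
    have hle := hmin (a + t • (-G))
    rw [add_sub_cancel_left, norm_smul, norm_neg, Real.norm_of_nonneg ht.le] at hle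
    simp only [zero_add, zero_smul, add_zero, smul_eq_mul]
    rw [inv_mul_eq_div, le_div_iff₀ ht]
    linarith
  rcases (norm_nonneg G).eq_or_lt with h | h
  · rwa [← h]
  · nlinarith

theorem hasGradientAt_half_norm_sub_sq {E : Type*} [NormedAddCommGroup E]
    [InnerProductSpace ℝ E] [CompleteSpace E] (a b : E) :
    HasGradientAt (fun w => (1 / 2 : ℝ) * ‖w - b‖ ^ 2) (a - b) a := by
  rw [hasGradientAt_iff_hasFDerivAt]
  refine ((((hasFDerivAt_id a).sub_const b).norm_sq).const_mul (1 / 2 : ℝ)).congr_fderiv ?_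
  ext v
  simp

theorem hasGradientAt_norm_sub {E : Type*} [NormedAddCommGroup E]
    [InnerProductSpace ℝ E] [CompleteSpace E] {a b : E} (h : a ≠ b) :
    HasGradientAt (fun w => ‖w - b‖) (‖a - b‖⁻¹ • (a - b)) a := by
  have hpos : 0 < ‖a - b‖ := norm_pos_iff.2 (sub_ne_zero.2 h)
  rw [hasGradientAt_iff_hasFDerivAt]
  have hsq := (((hasFDerivAt_id a).sub_const b).norm_sq).sqrt (by simpa using hpos.ne')
  simp only [id_eq, Real.sqrt_sq (norm_nonneg _)] at hsq
  refine hsq.congr_fderiv ?_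
  ext v
  simp
  field_simp

/-- A sum of a symmetric function over pairs `b < a` splits into the pairs containing a given
index `i` and the pairs avoiding it. -/
theorem sum_sum_Iio_eq_sum_erase_add {ι : Type*} [Fintype ι] [LinearOrder ι]
    [LocallyFiniteOrderBot ι] (F : ι → ι → ℝ) (hF : ∀ a b, F a b = F b a) (i : ι) :
    ∑ a, ∑ b ∈ Finset.Iio a, F a b = ∑ j ∈ Finset.univ.erase i, F i j +
      ∑ a ∈ Finset.univ.erase i, ∑ b ∈ (Finset.Iio a).erase i, F a b := by
  have hsplit : ∀ a ∈ Finset.univ.erase i, ∑ b ∈ Finset.Iio a, F a b =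
      (if i < a then F i a else 0) + ∑ b ∈ (Finset.Iio a).erase i, F a b := by
    intro a _
    split_ifs with h
    · rw [hF i a, Finset.add_sum_erase _ _ (Finset.mem_Iio.2 h)]
    · rw [Finset.erase_eq_of_notMem (by simpa using h), zero_add]
  have hlow : ∑ b ∈ Finset.Iio i, F i b =
      ∑ b ∈ Finset.univ.erase i, if b < i then F i b else 0 := by
    rw [← Finset.sum_filter]
    refine Finset.sum_congr ?_ fun _ _ => rfl
    ext b
    simpa using fun h : b < i => h.ne
  rw [← Finset.add_sum_erase _ _ (Finset.mem_univ i), Finset.sum_congr rfl hsplit,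
    Finset.sum_add_distrib, hlow, ← add_assoc, ← Finset.sum_add_distrib]
  congr 1
  refine Finset.sum_congr rfl fun b hb => ?_
  rcases lt_or_gt_of_ne (Finset.ne_of_mem_erase hb) with h | h <;> simp [h, h.not_gt]

/-- The part of the objective, as a function of the `i`-th point `w`, that is differentiable at
`u i`. -/
noncomputable def ccSmoothPart {d n : ℕ} (x : Fin n → EuclideanSpace ℝ (Fin d)) (lam : ℝ)
    (u : Fin n → EuclideanSpace ℝ (Fin d)) (i : Fin n) (w : EuclideanSpace ℝ (Fin d)) : ℝ :=
  (1 / 2) * ‖w - x i‖ ^ 2 +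
    lam * ∑ j ∈ Finset.univ.filter (fun j => u j ≠ u i), ‖w - u j‖

theorem hasGradientAt_ccSmoothPart {d n : ℕ} (x : Fin n → EuclideanSpace ℝ (Fin d)) (lam : ℝ)
    (u : Fin n → EuclideanSpace ℝ (Fin d)) (i : Fin n) :
    HasGradientAt (ccSmoothPart x lam u i) (ccCenter u lam i - x i) (u i) := by
  have hsum := HasFDerivAt.fun_sum (u := Finset.univ.filter (fun j => u j ≠ u i))
    fun j hj => (hasGradientAt_norm_sub (Finset.mem_filter.1 hj).2.symm).hasFDerivAt
  have hadd := (hasGradientAt_half_norm_sub_sq (u i) (x i)).hasFDerivAt.add (hsum.const_mul lam)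
  rw [hasGradientAt_iff_hasFDerivAt]
  refine hadd.congr_fderiv ?_
  rw [← map_sum, ccCenter, ccE, add_sub_right_comm, map_add]
  simp

theorem ccObj_update {d n : ℕ} (x : Fin n → EuclideanSpace ℝ (Fin d)) (lam : ℝ)
    (u : Fin n → EuclideanSpace ℝ (Fin d)) (i : Fin n) (w : EuclideanSpace ℝ (Fin d)) :
    ccObj x lam (Function.update u i w) =
      ccSmoothPart x lam u i w + ccRadius u lam i * ‖w - u i‖ +
        ((1 / 2) * ∑ a ∈ Finset.univ.erase i, ‖u a - x a‖ ^ 2 +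
          lam * ∑ a ∈ Finset.univ.erase i, ∑ b ∈ (Finset.Iio a).erase i, ‖u a - u b‖) := by
  have hfid : ∑ a, ‖Function.update u i w a - x a‖ ^ 2 =
      ‖w - x i‖ ^ 2 + ∑ a ∈ Finset.univ.erase i, ‖u a - x a‖ ^ 2 := by
    rw [← Finset.add_sum_erase _ _ (Finset.mem_univ i), Function.update_self]
    congr 1
    refine Finset.sum_congr rfl fun a ha => ?_
    rw [Function.update_of_ne (Finset.ne_of_mem_erase ha)]
  have hself : ∑ j ∈ Finset.univ.erase i,
      ‖Function.update u i w i - Function.update u i w j‖ =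
        ∑ j ∈ Finset.univ.erase i, ‖w - u j‖ := by
    refine Finset.sum_congr rfl fun a ha => ?_
    rw [Function.update_self, Function.update_of_ne (Finset.ne_of_mem_erase ha)]
  have hrest : ∑ a ∈ Finset.univ.erase i, ∑ b ∈ (Finset.Iio a).erase i,
      ‖Function.update u i w a - Function.update u i w b‖ =
        ∑ a ∈ Finset.univ.erase i, ∑ b ∈ (Finset.Iio a).erase i, ‖u a - u b‖ := by
    refine Finset.sum_congr rfl fun a ha => Finset.sum_congr rfl fun b hb => ?_
    rw [Function.update_of_ne (Finset.ne_of_mem_erase ha),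
      Function.update_of_ne (Finset.ne_of_mem_erase hb)]
  have hcluster : ∑ j ∈ Finset.univ.filter (fun j => u j = u i), ‖w - u j‖ =
      ccCard u i * ‖w - u i‖ := by
    rw [Finset.sum_congr rfl fun j hj => by rw [(Finset.mem_filter.1 hj).2], Finset.sum_const,
      nsmul_eq_mul, ccCard]
  have herase := Finset.add_sum_erase Finset.univ (fun j => ‖w - u j‖) (Finset.mem_univ i)
  rw [← Finset.sum_filter_add_sum_filter_not Finset.univ (fun j => u j = u i), hcluster] at herase
  rw [ccObj, hfid, sum_sum_Iio_eq_sum_erase_add _ (fun _ _ => norm_sub_rev _ _) i, hself, hrest,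
    ccSmoothPart, ccRadius]
  linear_combination lam * herase

theorem ccRadius_nonneg {d n : ℕ} (u : Fin n → EuclideanSpace ℝ (Fin d)) {lam : ℝ}
    (hlam : 0 ≤ lam) (i : Fin n) : 0 ≤ ccRadius u lam i := by
  have hcard : 1 ≤ ccCard u i := Finset.card_pos.2 ⟨i, by simp⟩
  exact mul_nonneg hlam (sub_nonneg.2 (mod_cast hcard))

/-- Each data point `x_i` lies in the closed ball of center `c(i) = ū_i + λ·E_i` and
radius `r(i) = λ·(n(i) − 1)`. -/
theorem convex_clustering_bounding_ball {d n : ℕ} (hd : 0 < d) (hn : 0 < n)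
    (x : Fin n → EuclideanSpace ℝ (Fin d)) (lam : ℝ) (hlam : 0 < lam)
    (ubar : Fin n → EuclideanSpace ℝ (Fin d))
    (hmin : ∀ u : Fin n → EuclideanSpace ℝ (Fin d), ccObj x lam ubar ≤ ccObj x lam u)
    (i : Fin n) :
    ‖x i - ccCenter ubar lam i‖ ≤ ccRadius ubar lam i := by
  rw [norm_sub_rev]
  refine norm_gradient_le_of_forall_le_add_mul_norm (hasGradientAt_ccSmoothPart x lam ubar i)
    (ccRadius_nonneg ubar hlam.le i) fun w => ?_
  have hle := hmin (Function.update ubar i w)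
  have hself := ccObj_update x lam ubar i (ubar i)
  rw [Function.update_eq_self, sub_self, norm_zero, mul_zero, add_zero] at hself
  rw [hself, ccObj_update] at hle
  linarith
end

section
/- Let ū be a global minimizer of the convex clustering objective f. Then for every index i, the ball center c(i) = ū_i + λ·E_i equals the mean of the data points in the cluster of i, i.e., ū_i + λ·E_i = (1/n(i))·Σ_{j : ū_j = ū_i} x_j. -/
open scoped RealInnerProductSpace Classical

/-- A norm along a line is differentiable at `0` if it starts off the origin or is constant. -/
lemma hasDerivAt_norm_add_smul {E : Type*} [NormedAddCommGroup E] [InnerProductSpace ℝ E]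
    {a b : E} (hab : a = 0 → b = 0) :
    HasDerivAt (fun t : ℝ => ‖a + t • b‖) ⟪‖a‖⁻¹ • a, b⟫ 0 := by
  by_cases ha : a = 0
  · simpa [ha, hab ha] using hasDerivAt_const (0 : ℝ) (0 : ℝ)
  · have hline : HasDerivAt (fun t : ℝ => a + t • b) b 0 := by
      simpa using ((hasDerivAt_id (0 : ℝ)).smul_const b).const_add a
    have hsq : HasDerivAt (fun t : ℝ => ‖a + t • b‖ ^ 2) (2 * ⟪a, b⟫) 0 := by
      simpa using hline.norm_sq
    have hsqrt := hsq.sqrt (by simpa using ha)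
    simp only [Real.sqrt_sq (norm_nonneg _), zero_smul, add_zero] at hsqrt
    convert hsqrt using 1
    rw [real_inner_smul_left]
    field_simp

/-- A double sum over all pairs, folded onto the pairs `j < k`. -/
lemma sum_sum_Iio_add_swap {n : ℕ} (G : Fin n → Fin n → ℝ) (hG : ∀ k, G k k = 0) :
    ∑ k, ∑ j ∈ Finset.Iio k, (G k j + G j k) = ∑ k, ∑ j, G k j := by
  have hIio (H : Fin n → Fin n → ℝ) :
      ∑ k, ∑ j ∈ Finset.Iio k, H k j = ∑ k, ∑ j, if j < k then H k j else 0 := by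
    refine Finset.sum_congr rfl fun k _ => ?_
    rw [← Finset.sum_filter]
    congr 1
    ext j
    simp
  simp_rw [Finset.sum_add_distrib]
  rw [hIio, hIio (fun k j => G j k),
    Finset.sum_comm (f := fun k j => if j < k then G j k else 0), ← Finset.sum_add_distrib]
  refine Finset.sum_congr rfl fun k _ => ?_
  rw [← Finset.sum_add_distrib]
  refine Finset.sum_congr rfl fun j _ => ?_
  rcases lt_trichotomy j k with h | rfl | h
  · simp [h, h.not_gt]
  · simp [hG]
  · simp [h, h.not_gt]

lemma ccE_eq_sum {d n : ℕ} (u : Fin n → EuclideanSpace ℝ (Fin d)) (i : Fin n) :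
    ccE u i = ∑ j, ‖u i - u j‖⁻¹ • (u i - u j) := by
  refine Finset.sum_filter_of_ne fun j _ hj h => hj ?_
  simp [h]

lemma ccE_congr {d n : ℕ} {u : Fin n → EuclideanSpace ℝ (Fin d)} {i k : Fin n}
    (h : u k = u i) : ccE u k = ccE u i := by
  simp only [ccE, h]

/-- The derivative of the objective along a direction that is constant on clusters. -/
lemma hasDerivAt_ccObj {d n : ℕ} (x : Fin n → EuclideanSpace ℝ (Fin d)) (lam : ℝ)
    (u v : Fin n → EuclideanSpace ℝ (Fin d)) (hv : ∀ k j, u k = u j → v k = v j) :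
    HasDerivAt (fun t : ℝ => ccObj x lam (fun k => u k + t • v k))
      (∑ k, ⟪u k - x k + lam • ccE u k, v k⟫) 0 := by
  have hfit (k : Fin n) :
      HasDerivAt (fun t : ℝ => ‖u k + t • v k - x k‖ ^ 2) (2 * ⟪u k - x k, v k⟫) 0 := by
    have hline : HasDerivAt (fun t : ℝ => u k + t • v k - x k) (v k) 0 := by
      simpa using (((hasDerivAt_id (0 : ℝ)).smul_const (v k)).const_add (u k)).sub_const (x k)
    simpa using hline.norm_sq
  have hpair (k j : Fin n) :
      HasDerivAt (fun t : ℝ => ‖(u k + t • v k) - (u j + t • v j)‖)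
        (⟪‖u k - u j‖⁻¹ • (u k - u j), v k⟫ + ⟪‖u j - u k‖⁻¹ • (u j - u k), v j⟫) 0 := by
    have h := hasDerivAt_norm_add_smul (a := u k - u j) (b := v k - v j)
      fun h => sub_eq_zero.2 (hv k j (sub_eq_zero.1 h))
    convert h using 1
    · funext t
      congr 1
      module
    · rw [norm_sub_rev (u j), ← neg_sub (u k) (u j), smul_neg, inner_neg_left, inner_sub_right,
        ← sub_eq_add_neg]
  have h := ((HasDerivAt.fun_sum fun k (_ : k ∈ Finset.univ) => hfit k).const_mul
    (1 / 2 : ℝ)).fun_add ((HasDerivAt.fun_sum fun k (_ : k ∈ Finset.univ) =>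
      HasDerivAt.fun_sum fun j (_ : j ∈ Finset.Iio k) => hpair k j).const_mul lam)
  refine h.congr_deriv ?_
  rw [sum_sum_Iio_add_swap (fun k j => ⟪‖u k - u j‖⁻¹ • (u k - u j), v k⟫) (by simp),
    Finset.mul_sum, Finset.mul_sum, ← Finset.sum_add_distrib]
  refine Finset.sum_congr rfl fun k _ => ?_
  rw [inner_add_left, real_inner_smul_left, ccE_eq_sum, sum_inner]
  ring

/-- The bounding-ball center `c(i) = ū_i + λ·E_i` is the mean of the data points in the
cluster of `i`. -/
theorem convex_clustering_center_is_mean {d n : ℕ} (hd : 0 < d) (hn : 0 < n)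
    (x : Fin n → EuclideanSpace ℝ (Fin d)) (lam : ℝ) (hlam : 0 < lam)
    (ubar : Fin n → EuclideanSpace ℝ (Fin d))
    (hmin : ∀ u : Fin n → EuclideanSpace ℝ (Fin d), ccObj x lam ubar ≤ ccObj x lam u)
    (i : Fin n) :
    ccCenter ubar lam i =
      ((ccCard ubar i : ℝ))⁻¹ • ∑ j ∈ Finset.univ.filter (fun j => ubar j = ubar i), x j := by
  set V := Finset.univ.filter (fun j => ubar j = ubar i) with hV
  have hstat : ∑ k ∈ V, (ubar k - x k + lam • ccE ubar k) = 0 := by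
    refine ext_inner_right ℝ fun w => ?_
    have hderiv := hasDerivAt_ccObj x lam ubar (fun k => if ubar k = ubar i then w else 0)
      fun k j h => by simp only [h]
    have hzero := IsLocalMin.hasDerivAt_eq_zero
      (Filter.Eventually.of_forall fun t => by simpa using hmin _) hderiv
    rw [inner_zero_left, sum_inner, hV, Finset.sum_filter]
    refine Eq.trans (Finset.sum_congr rfl fun k _ => ?_) hzero
    split_ifs <;> simp
  have hcenter : ∀ k ∈ V, ubar k - x k + lam • ccE ubar k = ccCenter ubar lam i - x k := by
    intro k hk
    have hki : ubar k = ubar i := (Finset.mem_filter.1 hk).2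
    rw [ccCenter, ccE_congr hki, hki]
    abel
  rw [Finset.sum_congr rfl hcenter, Finset.sum_sub_distrib, Finset.sum_const, sub_eq_zero,
    ← Nat.cast_smul_eq_nsmul ℝ] at hstat
  have hcard : (ccCard ubar i : ℝ) ≠ 0 :=
    Nat.cast_ne_zero.2 (Finset.card_ne_zero_of_mem (a := i) (by simp))
  rw [← hstat]
  exact (inv_smul_smul₀ hcard _).symm
end

section
/- (Tightness of bounding balls, core inequality.) Let λ > 0, let S be a finite index set of cardinality q ≥ 1, let v₀ ∈ ℝ^d be a unit vector, and fix p ∈ S. Define v_p = λ·(q − 1)·v₀ and v_j = −λ·v₀ for every j ∈ S with j ≠ p. Then for every family of vectors ε : S → ℝ^d, Σ_{i∈S} ⟨v_i, ε_i⟩ + λ·Σ_{unordered pairs {i,j} ⊆ S, i ≠ j} ‖ε_i − ε_j‖ ≥ 0. -/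
open scoped RealInnerProductSpace Classical

/-- The pairs through a fixed element `p` contribute twice to a sum of nonnegative symmetric
terms over ordered pairs. -/
theorem Finset.two_mul_sum_erase_le_sum_offDiag {ι : Type*} [DecidableEq ι] (S : Finset ι) {p : ι}
    (hp : p ∈ S) (f : ι → ι → ℝ) (hf : ∀ i j, 0 ≤ f i j) (hsymm : ∀ i j, f i j = f j i) :
    2 * ∑ j ∈ S.erase p, f p j ≤ ∑ q ∈ S.offDiag, f q.1 q.2 := by
  have hdisj : Disjoint ({p} ×ˢ S.erase p) (S.erase p ×ˢ {p}) := by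
    rw [Finset.disjoint_left]
    rintro ⟨a, b⟩ h₁ h₂
    simp only [Finset.mem_product, Finset.mem_singleton, Finset.mem_erase] at h₁ h₂
    exact h₂.1.1 h₁.1
  have hsub : {p} ×ˢ S.erase p ∪ S.erase p ×ˢ {p} ⊆ S.offDiag := by
    rintro ⟨a, b⟩ h
    simp only [Finset.mem_union, Finset.mem_product, Finset.mem_singleton, Finset.mem_erase,
      Finset.mem_offDiag] at h ⊢
    rcases h with ⟨rfl, hb, hbS⟩ | ⟨⟨ha, haS⟩, rfl⟩
    · exact ⟨hp, hbS, hb.symm⟩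
    · exact ⟨haS, hp, ha⟩
  calc 2 * ∑ j ∈ S.erase p, f p j
      = ∑ q ∈ {p} ×ˢ S.erase p ∪ S.erase p ×ˢ {p}, f q.1 q.2 := by
        rw [Finset.sum_union hdisj, Finset.sum_product, Finset.sum_product]
        simp only [Finset.sum_singleton, hsymm _ p]
        ring
    _ ≤ ∑ q ∈ S.offDiag, f q.1 q.2 :=
        Finset.sum_le_sum_of_subset_of_nonneg hsub fun q _ _ => hf q.1 q.2

/-- Tightness of the bounding balls, core inequality: for the configuration placing one
point on the boundary of the bounding ball, every directional derivative of the convex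
clustering objective is nonnegative.  The sum over unordered pairs `{i, j} ⊆ S`, `i ≠ j`,
is written as half the sum over ordered pairs in `S.offDiag`. -/
theorem convex_clustering_ball_tight {d : ℕ} (hd : 0 < d) {ι : Type*} [DecidableEq ι]
    (S : Finset ι) (hq : 1 ≤ S.card) (lam : ℝ) (hlam : 0 < lam)
    (v₀ : EuclideanSpace ℝ (Fin d)) (hv₀ : ‖v₀‖ = 1)
    (p : ι) (hp : p ∈ S)
    (v : ι → EuclideanSpace ℝ (Fin d))
    (hvp : v p = (lam * ((S.card : ℝ) - 1)) • v₀)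
    (hvj : ∀ j ∈ S, j ≠ p → v j = (-lam) • v₀)
    (ε : ι → EuclideanSpace ℝ (Fin d)) :
    0 ≤ ∑ i ∈ S, ⟪v i, ε i⟫ +
        lam * ((1 / 2) * ∑ q ∈ S.offDiag, ‖ε q.1 - ε q.2‖) := by
  have hpairs := Finset.two_mul_sum_erase_le_sum_offDiag S hp (fun i j => ‖ε i - ε j‖)
    (fun _ _ => norm_nonneg _) fun _ _ => norm_sub_rev _ _
  have hcard : ((S.erase p).card : ℝ) = (S.card : ℝ) - 1 := by
    rw [Finset.card_erase_of_mem hp, Nat.cast_sub hq, Nat.cast_one]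
  have hlinear : ∑ i ∈ S, ⟪v i, ε i⟫ = lam * ∑ j ∈ S.erase p, ⟪v₀, ε p - ε j⟫ := by
    have hrest : ∑ j ∈ S.erase p, ⟪v j, ε j⟫ = -lam * ∑ j ∈ S.erase p, ⟪v₀, ε j⟫ := by
      rw [Finset.mul_sum]
      refine Finset.sum_congr rfl fun j hj => ?_
      rw [hvj j (Finset.mem_of_mem_erase hj) (Finset.ne_of_mem_erase hj), real_inner_smul_left]
    rw [← Finset.add_sum_erase S _ hp, hrest, hvp, real_inner_smul_left]
    simp only [inner_sub_right, Finset.sum_sub_distrib, Finset.sum_const, nsmul_eq_mul, hcard]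
    ring
  have hcauchy : -∑ j ∈ S.erase p, ‖ε p - ε j‖ ≤ ∑ j ∈ S.erase p, ⟪v₀, ε p - ε j⟫ := by
    rw [← Finset.sum_neg_distrib]
    refine Finset.sum_le_sum fun j _ => ?_
    have h := neg_le_of_abs_le (abs_real_inner_le_norm v₀ (ε p - ε j))
    rwa [hv₀, one_mul] at h
  rw [hlinear, ← mul_add]
  exact mul_nonneg hlam.le (by linarith)
end

section
/- (Upper bound on λ for nontrivial solutions.) Let ū be a global minimizer of the convex clustering objective f. If there exist indices i and j with ū_i ≠ ū_j (i.e., more than one cluster), then there exist indices p ≠ q with ‖x_p − x_q‖ > 2λ; in particular 2λ < max_{i≠j} ‖x_i − x_j‖. -/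
open scoped RealInnerProductSpace Classical

/-- A symmetric double sum vanishing on the diagonal is twice its sum below the diagonal. -/
theorem sum_sum_eq_two_mul_sum_Iio_s7 {n : ℕ} (g : Fin n → Fin n → ℝ)
    (symm : ∀ i j, g i j = g j i) (diag : ∀ i, g i i = 0) :
    ∑ i, ∑ j, g i j = 2 * ∑ i, ∑ j ∈ Finset.Iio i, g i j := by
  have hupper : ∑ i, ∑ j ∈ Finset.Ioi i, g i j = ∑ i, ∑ j ∈ Finset.Iio i, g i j := by
    rw [Finset.sum_comm' (t' := Finset.univ) (s' := fun j => Finset.Iio j) (by simp)]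
    exact Finset.sum_congr rfl fun i _ => Finset.sum_congr rfl fun j _ => symm j i
  have hsplit (i : Fin n) :
      ∑ j, g i j = ∑ j ∈ Finset.Iio i, g i j + ∑ j ∈ Finset.Ioi i, g i j := by
    simp only [← Finset.filter_gt_eq_Iio, ← Finset.filter_lt_eq_Ioi, Finset.sum_filter,
      ← Finset.sum_add_distrib]
    refine Finset.sum_congr rfl fun j _ => ?_
    rcases lt_trichotomy i j with h | h | h
    · simp [h, h.not_gt]
    · simp [← h, diag]
    · simp [h, h.not_gt]
  rw [Finset.sum_congr rfl fun i _ => hsplit i, Finset.sum_add_distrib, hupper, two_mul]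

/-- The double sum of inner products of differences, centred at the mean `m` of `x`. -/
theorem sum_sum_inner_sub_sub {E : Type*} [NormedAddCommGroup E] [InnerProductSpace ℝ E]
    {n : ℕ} (u x : Fin n → E) (m : E) (hm : ∑ i, x i = (n : ℝ) • m) :
    ∑ i, ∑ j, ⟪u i - u j, x i - x j⟫ = -(2 * n) * ∑ i, ⟪u i - m, m - x i⟫ := by
  simp only [inner_sub_left, inner_sub_right, Finset.sum_sub_distrib, ← inner_sum, ← sum_inner,
    hm, Finset.sum_const, Finset.card_univ, Fintype.card_fin, ← Nat.cast_smul_eq_nsmul ℝ,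
    inner_smul_right, ← Finset.mul_sum]
  ring

/-- If all data points are within `2 * lam` of each other, the constant configuration at their
mean beats any other configuration by at least half the squared distance between the two. -/
theorem ccObj_mean_add_le {d n : ℕ} (hn : 2 ≤ n) (x : Fin n → EuclideanSpace ℝ (Fin d))
    {lam : ℝ} (hx : ∀ p q, ‖x p - x q‖ ≤ 2 * lam) (m : EuclideanSpace ℝ (Fin d))
    (hm : ∑ i, x i = (n : ℝ) • m) (u : Fin n → EuclideanSpace ℝ (Fin d)) :
    ccObj x lam (fun _ => m) + (1 / 2) * ∑ i, ‖u i - m‖ ^ 2 ≤ ccObj x lam u := by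
  have hn' : (2 : ℝ) ≤ n := by exact_mod_cast hn
  have hexpand : ∑ i, ‖u i - x i‖ ^ 2 =
      ∑ i, ‖u i - m‖ ^ 2 + 2 * ∑ i, ⟪u i - m, m - x i⟫ + ∑ i, ‖m - x i‖ ^ 2 := by
    rw [Finset.mul_sum, ← Finset.sum_add_distrib, ← Finset.sum_add_distrib]
    refine Finset.sum_congr rfl fun i _ => ?_
    rw [← norm_add_sq_real, sub_add_sub_cancel]
  have hbound : ∑ i, ∑ j, ⟪u i - u j, x i - x j⟫ ≤ 2 * lam * ∑ i, ∑ j, ‖u i - u j‖ := by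
    simp only [Finset.mul_sum]
    refine Finset.sum_le_sum fun i _ => Finset.sum_le_sum fun j _ => ?_
    rw [mul_comm]
    exact (real_inner_le_norm _ _).trans (mul_le_mul_of_nonneg_left (hx i j) (norm_nonneg _))
  rw [sum_sum_inner_sub_sub u x m hm, sum_sum_eq_two_mul_sum_Iio_s7 (fun i j => ‖u i - u j‖)
    (fun i j => norm_sub_rev _ _) (by simp)] at hbound
  have hlam : 0 ≤ lam := by
    have := (norm_nonneg _).trans (hx ⟨0, by omega⟩ ⟨0, by omega⟩)
    linarith
  have hnonneg : 0 ≤ lam * ∑ i, ∑ j ∈ Finset.Iio i, ‖u i - u j‖ := by positivity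
  have hcross : 0 ≤ lam * ∑ i, ∑ j ∈ Finset.Iio i, ‖u i - u j‖ + ∑ i, ⟪u i - m, m - x i⟫ := by
    by_contra! h
    nlinarith
  simp only [ccObj, hexpand, sub_self, norm_zero, Finset.sum_const_zero, mul_zero, add_zero]
  linarith

/-- Upper bound on `λ` for nontrivial solutions: if a global minimizer has more than one
cluster, then some pair of data points is more than `2λ` apart. -/
theorem convex_clustering_lambda_upper_bound {d n : ℕ} (hd : 0 < d) (hn : 2 ≤ n)
    (x : Fin n → EuclideanSpace ℝ (Fin d)) (lam : ℝ) (hlam : 0 < lam)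
    (ubar : Fin n → EuclideanSpace ℝ (Fin d))
    (hmin : ∀ u : Fin n → EuclideanSpace ℝ (Fin d), ccObj x lam ubar ≤ ccObj x lam u)
    (i j : Fin n) (hij : ubar i ≠ ubar j) :
    ∃ p q : Fin n, p ≠ q ∧ 2 * lam < ‖x p - x q‖ := by
  by_contra! h
  have hx (p q : Fin n) : ‖x p - x q‖ ≤ 2 * lam := by
    rcases eq_or_ne p q with rfl | hpq
    · simpa using hlam.le
    · exact h p q hpq
  have hn0 : (n : ℝ) ≠ 0 := by positivity
  set m := (n : ℝ)⁻¹ • ∑ i, x i with hm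
  have hle := ccObj_mean_add_le hn x hx m (by rw [hm, smul_inv_smul₀ hn0]) ubar
  have hsum : ∑ i, ‖ubar i - m‖ ^ 2 = 0 :=
    le_antisymm (by linarith [hmin fun _ => m]) (by positivity)
  have heq (k : Fin n) : ubar k = m := by
    have := (Finset.sum_eq_zero_iff_of_nonneg fun i _ => sq_nonneg ‖ubar i - m‖).mp hsum k
      (Finset.mem_univ k)
    simpa [sub_eq_zero] using this
  exact hij ((heq i).trans (heq j).symm)
end

section
/- (Impossibility of nontrivial clustering for equally spaced collinear data.) Let n ≥ 2, let the data be the real numbers x_i = i for i = 1,…,n (so d = 1), let λ > 0, and let ū ∈ ℝ^n be a global minimizer of the convex clustering objective f. Then either all the ū_i are equal (one cluster) or the ū_i are pairwise distinct (n clusters); no nontrivial clustering with 1 < k < n clusters is possible for any λ. -/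
/-- Summing all ordered differences weights each entry by the number of smaller indices minus the
number of larger ones. -/
theorem sum_sum_Iio_sub {n : ℕ} (w : Fin n → ℝ) :
    ∑ i, ∑ j ∈ Finset.Iio i, (w i - w j) = ∑ i : Fin n, (2 * (i : ℝ) - n + 1) * w i := by
  have hswap : ∑ i, ∑ j ∈ Finset.Iio i, w j = ∑ j, ∑ _i ∈ Finset.Ioi j, w j :=
    Finset.sum_comm' (by simp)
  simp only [Finset.sum_sub_distrib]
  rw [hswap, ← Finset.sum_sub_distrib]
  refine Finset.sum_congr rfl fun i _ => ?_
  have hcard : ((n - 1 - (i : ℕ) : ℕ) : ℝ) = n - 1 - (i : ℝ) := by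
    have hi := i.isLt
    rw [Nat.cast_sub (by omega), Nat.cast_sub (by omega), Nat.cast_one]
  simp only [Finset.sum_const, Fin.card_Iio, Fin.card_Ioi, nsmul_eq_mul, hcard]
  ring

/-- If the shrinkage factor `c` is `min 1 (2 * lam)`, the shrunken data
`i + 1 - c * (i - (n - 1) / 2)` is the only possible minimizer. -/
theorem convex_clustering_minimizer_eq {n : ℕ} {lam c : ℝ} (hc0 : 0 ≤ c) (hc1 : c ≤ 1)
    (hclam : c ≤ 2 * lam) (hc : c = 2 * lam ∨ c = 1) {u : Fin n → ℝ}
    (hmin : ∀ v : Fin n → ℝ,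
      (1 / 2) * ∑ i, (u i - ((i : ℝ) + 1)) ^ 2 +
          lam * ∑ i, ∑ j ∈ Finset.Iio i, |u i - u j| ≤
        (1 / 2) * ∑ i, (v i - ((i : ℝ) + 1)) ^ 2 +
          lam * ∑ i, ∑ j ∈ Finset.Iio i, |v i - v j|) (i : Fin n) :
    u i = (i : ℝ) + 1 - c * ((i : ℝ) - (n - 1) / 2) := by
  let v : Fin n → ℝ := fun i => (i : ℝ) + 1 - c * ((i : ℝ) - (n - 1) / 2)
  have hpair : c / 2 * ∑ i, ∑ j ∈ Finset.Iio i, ((u i - v i) - (u j - v j)) ≤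
      lam * ∑ i, ∑ j ∈ Finset.Iio i, |u i - u j| -
        lam * ∑ i, ∑ j ∈ Finset.Iio i, |v i - v j| := by
    simp only [Finset.mul_sum, ← Finset.sum_sub_distrib]
    refine Finset.sum_le_sum fun i _ => Finset.sum_le_sum fun j hj => ?_
    have hji : (j : ℝ) ≤ i := by
      exact_mod_cast (Finset.mem_Iio.mp hj).le
    have hv : v i - v j = (1 - c) * ((i : ℝ) - j) := by simp only [v]; ring
    have hvabs : |v i - v j| = v i - v j :=
      abs_of_nonneg (hv ▸ mul_nonneg (by linarith) (by linarith))
    have hslack : (lam - c / 2) * (v i - v j) = 0 := by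
      rcases hc with h | h
      · rw [h]; ring
      · rw [hv, h]; ring
    have hu : c / 2 * (u i - u j) ≤ lam * |u i - u j| :=
      (mul_le_mul_of_nonneg_left (le_abs_self _) (by linarith)).trans
        (mul_le_mul_of_nonneg_right (by linarith) (abs_nonneg _))
    rw [hvabs]
    linarith
  have hquad : (1 / 2) * ∑ i, (u i - ((i : ℝ) + 1)) ^ 2 =
      (1 / 2) * ∑ i, (v i - ((i : ℝ) + 1)) ^ 2 + (1 / 2) * ∑ i, (u i - v i) ^ 2 -
        c / 2 * ∑ i : Fin n, (2 * (i : ℝ) - n + 1) * (u i - v i) := by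
    simp only [Finset.mul_sum, ← Finset.sum_sub_distrib, ← Finset.sum_add_distrib]
    refine Finset.sum_congr rfl fun i _ => ?_
    simp only [v]
    ring
  rw [sum_sum_Iio_sub fun i => u i - v i] at hpair
  have hle : ∑ i, (u i - v i) ^ 2 ≤ 0 := by linarith [hmin v]
  have hsq : (u i - v i) ^ 2 ≤ 0 :=
    (Finset.single_le_sum (f := fun i => (u i - v i) ^ 2) (fun _ _ => sq_nonneg _)
      (Finset.mem_univ i)).trans hle
  exact sub_eq_zero.mp (pow_eq_zero_iff two_ne_zero |>.mp (le_antisymm hsq (sq_nonneg _)))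

/-- Impossibility of nontrivial clustering for equally spaced collinear data:
for data `x_i = i` on the real line (`d = 1`), any global minimizer of the
convex clustering objective yields either one cluster (all prototypes equal) or
`n` clusters (all prototypes pairwise distinct), for every `λ > 0`. -/
theorem convex_clustering_collinear_trivial {n : ℕ} (hn : 2 ≤ n) (lam : ℝ) (hlam : 0 < lam)
    (ubar : Fin n → ℝ)
    (hmin : ∀ u : Fin n → ℝ,
      (1 / 2) * ∑ i, (ubar i - ((i : ℝ) + 1)) ^ 2 +
          lam * ∑ i, ∑ j ∈ Finset.Iio i, |ubar i - ubar j| ≤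
        (1 / 2) * ∑ i, (u i - ((i : ℝ) + 1)) ^ 2 +
          lam * ∑ i, ∑ j ∈ Finset.Iio i, |u i - u j|) :
    (∀ i j : Fin n, ubar i = ubar j) ∨ Function.Injective ubar := by
  rcases lt_or_ge (2 * lam) 1 with h | h
  · right
    intro i j hij
    have key := convex_clustering_minimizer_eq (by linarith) h.le le_rfl (Or.inl rfl) hmin
    rw [key i, key j] at hij
    have hprod : (1 - 2 * lam) * ((i : ℝ) - j) = 0 := by linarith
    have hcast : (i : ℝ) = j :=
      sub_eq_zero.mp ((mul_eq_zero.mp hprod).resolve_left (by linarith))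
    exact Fin.ext (by exact_mod_cast hcast)
  · left
    intro i j
    have key := convex_clustering_minimizer_eq zero_le_one le_rfl h (Or.inr rfl) hmin
    rw [key i, key j]
    ring
end

section
/- (Directional derivative of the convex clustering objective.) Let u = (u_1,…,u_n) ∈ (ℝ^d)^n and define E_i(u) = Σ_{j : u_j ≠ u_i} (u_i − u_j)/‖u_i − u_j‖ for each i. Then for every direction ε = (ε_1,…,ε_n) ∈ (ℝ^d)^n, the one-sided limit lim_{γ → 0⁺} (f(u + γ·ε) − f(u))/γ exists and equals Σ_{i=1}^n ⟨u_i − x_i + λ·E_i(u), ε_i⟩ + λ·Σ_{1≤j<i≤n, u_i = u_j} ‖ε_i − ε_j‖. -/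
open scoped RealInnerProductSpace Classical

open Finset in
/-- A double sum with vanishing diagonal, folded onto the strictly lower triangular pairs. -/
theorem sum_sum_Iio_add_swap_s10 {ι M : Type*} [LinearOrder ι] [Fintype ι] [LocallyFiniteOrder ι]
    [LocallyFiniteOrderBot ι] [LocallyFiniteOrderTop ι] [AddCommMonoid M] (h : ι → ι → M)
    (h_diag : ∀ i, h i i = 0) :
    ∑ i, ∑ j ∈ Iio i, (h i j + h j i) = ∑ i, ∑ j, h i j := by
  have h_swap : ∑ i, ∑ j ∈ Iio i, h j i = ∑ i, ∑ j ∈ Ioi i, h i j :=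
    sum_comm' (by simp)
  simp_rw [sum_add_distrib]
  rw [h_swap, ← sum_add_distrib]
  refine sum_congr rfl fun i _ => ?_
  rw [← sum_union (disjoint_left.2 fun j hj hj' => lt_asymm (mem_Iio.1 hj) (mem_Ioi.1 hj'))]
  refine sum_subset (subset_univ _) fun j _ hj => ?_
  obtain rfl : j = i := by
    simp only [mem_union, mem_Iio, mem_Ioi, not_or, not_lt] at hj
    exact le_antisymm hj.2 hj.1
  exact h_diag j

section NormAlongLine

variable {F : Type*} [NormedAddCommGroup F] [InnerProductSpace ℝ F]

theorem hasDerivAt_add_smul_zero (a v : F) : HasDerivAt (fun γ : ℝ => a + γ • v) v 0 := by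
  simpa using ((hasDerivAt_id (0 : ℝ)).smul_const v).const_add a

theorem hasDerivAt_norm_add_smul_sq (a v : F) :
    HasDerivAt (fun γ : ℝ => ‖a + γ • v‖ ^ 2) (2 * ⟪a, v⟫) 0 := by
  simpa using (hasDerivAt_add_smul_zero a v).norm_sq

theorem hasDerivWithinAt_norm_add_smul (a v : F) :
    HasDerivWithinAt (fun γ : ℝ => ‖a + γ • v‖)
      (if a = 0 then ‖v‖ else ‖a‖⁻¹ * ⟪a, v⟫) (Set.Ioi 0) 0 := by
  split_ifs with ha
  · have h := ((hasDerivAt_id (0 : ℝ)).mul_const ‖v‖).hasDerivWithinAt (s := Set.Ioi 0)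
    rw [one_mul] at h
    refine h.congr (fun γ hγ => ?_) (by simp [ha])
    simp [ha, norm_smul, abs_of_pos (Set.mem_Ioi.1 hγ)]
  · have h := (hasDerivAt_norm_add_smul_sq a v).sqrt (by simpa using ha)
    simp only [Real.sqrt_sq (norm_nonneg _)] at h
    refine (h.congr_deriv ?_).hasDerivWithinAt
    have : ‖a‖ ≠ 0 := norm_ne_zero_iff.2 ha
    simp only [zero_smul, add_zero]
    field_simp

end NormAlongLine

theorem sum_inner_ccE {d n : ℕ} (u ε : Fin n → EuclideanSpace ℝ (Fin d)) :
    ∑ i, ⟪ccE u i, ε i⟫ =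
      ∑ i, ∑ j ∈ Finset.Iio i,
        if u j = u i then 0 else ‖u i - u j‖⁻¹ * ⟪u i - u j, ε i - ε j⟫ := by
  have h_fold := sum_sum_Iio_add_swap_s10
    (fun i j => if u j = u i then 0 else ‖u i - u j‖⁻¹ * ⟪u i - u j, ε i⟫) (by simp)
  calc ∑ i, ⟪ccE u i, ε i⟫
      = ∑ i, ∑ j, if u j = u i then 0 else ‖u i - u j‖⁻¹ * ⟪u i - u j, ε i⟫ := by
        refine Finset.sum_congr rfl fun i _ => ?_
        rw [ccE, sum_inner, Finset.sum_filter]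
        simp only [real_inner_smul_left, ite_not]
    _ = _ := by
        rw [← h_fold]
        refine Finset.sum_congr rfl fun i _ => Finset.sum_congr rfl fun j _ => ?_
        by_cases hij : u j = u i
        · simp [hij]
        · rw [if_neg hij, if_neg (Ne.symm hij), if_neg hij, norm_sub_rev (u j), inner_sub_right,
            ← neg_sub (u i) (u j), inner_neg_left]
          ring

/-- Directional derivative of the convex clustering objective: for every `u` and every
direction `ε`, the one-sided limit of the difference quotient exists and equals
`Σ_i ⟪u_i − x_i + λ·E_i, ε_i⟫ + λ·Σ_{j<i, u_i = u_j} ‖ε_i − ε_j‖`. -/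
theorem convex_clustering_directional_derivative {d n : ℕ} (hd : 0 < d) (hn : 0 < n)
    (x : Fin n → EuclideanSpace ℝ (Fin d)) (lam : ℝ) (hlam : 0 < lam)
    (u ε : Fin n → EuclideanSpace ℝ (Fin d)) :
    Filter.Tendsto
      (fun γ : ℝ => (ccObj x lam (fun i => u i + γ • ε i) - ccObj x lam u) / γ)
      (nhdsWithin 0 (Set.Ioi 0))
      (nhds (∑ i, ⟪u i - x i + lam • ccE u i, ε i⟫ +
        lam * ∑ i, ∑ j ∈ (Finset.Iio i).filter (fun j => u j = u i), ‖ε i - ε j‖)) := by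
  have h_quad : HasDerivWithinAt
      (fun γ : ℝ => (1 / 2) * ∑ i, ‖u i + γ • ε i - x i‖ ^ 2)
      (∑ i, ⟪u i - x i, ε i⟫) (Set.Ioi 0) 0 := by
    have h := (HasDerivAt.fun_sum (u := Finset.univ) fun i _ =>
      hasDerivAt_norm_add_smul_sq (u i - x i) (ε i)).const_mul (1 / 2)
    simp only [← Finset.mul_sum, sub_add_eq_add_sub] at h
    exact (h.congr_deriv (by ring)).hasDerivWithinAt
  have h_pen : HasDerivWithinAt
      (fun γ : ℝ => lam * ∑ i, ∑ j ∈ Finset.Iio i, ‖u i + γ • ε i - (u j + γ • ε j)‖)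
      (lam * ∑ i, ∑ j ∈ Finset.Iio i, if u i - u j = 0 then ‖ε i - ε j‖
        else ‖u i - u j‖⁻¹ * ⟪u i - u j, ε i - ε j⟫) (Set.Ioi 0) 0 := by
    simp only [add_sub_add_comm, ← smul_sub]
    refine HasDerivWithinAt.const_mul lam
      (HasDerivWithinAt.fun_sum fun i _ => HasDerivWithinAt.fun_sum fun j _ => ?_)
    exact (hasDerivWithinAt_norm_add_smul (u i - u j) (ε i - ε j)).congr_deriv (by congr)
  have h_tendsto := (hasDerivWithinAt_iff_tendsto_slope' Set.self_notMem_Ioi).1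
    (h_quad.fun_add h_pen)
  convert h_tendsto using 2
  · simp [slope_def_field, ccObj]
  · simp only [inner_add_left, real_inner_smul_left, Finset.sum_add_distrib, ← Finset.mul_sum]
    rw [sum_inner_ccE, add_assoc, ← mul_add, ← Finset.sum_add_distrib]
    congr 2
    refine Finset.sum_congr rfl fun i _ => ?_
    rw [Finset.sum_filter, ← Finset.sum_add_distrib]
    refine Finset.sum_congr rfl fun j _ => ?_
    by_cases hij : u j = u i
    · simp [hij]
    · simp [hij, sub_eq_zero, Ne.symm hij]
end
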